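/- With L̂ the explicit 16×16 block tridiagonal matrix of the noncommuting-transitions example (blocks G_0, G_1, G_1, G_2 on the diagonal, ⌈A⌉ on the subdiagonal, ⌈C⌉ on the superdiagonal, for A = [[1,0],[1,−1]], C = [[1,1],[0,−1]]), let ρ = [[a, b],[b̄, 1−a]] be any 2×2 density matrix (positive semidefinite with trace 1) and define p_{00;ρ}(t) := Tr( vec^{-1}( (exp(t L̂))_{00} · vec(ρ) ) ), where (exp(t L̂))_{00} is the top-left 4×4 block and vec stacks the rows of a 2×2 matrix into ℂ⁴. Then for all t ≥ 0, p_{00;ρ}(t) = 1/4 + (e^{−λ₂t} − e^{−λ₃t})·v₁ + (e^{−λ₂t} + e^{−λ₃t})/8 + (e^{−λ₄t} − e^{−λ₅t})·v₂ + (e^{−λ₄t} + e^{−λ₅t})/4, where λ₂ = 3−√5, λ₃ = 3+√5, λ₄ = 3−√7, λ₅ = 3+√7, v₁ = (√5/40)(1 − 2a + 4·Re(b)), and v₂ = (√7/28)(2 − a + 2·Re(b)). -/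

import Mathlib

open Matrix Kronecker
open scoped ComplexOrder

/-- The matrix exponential `exp(A) = Σ_{k≥0} A^k / k!`. -/
noncomputable def matExp {m : Type*} [Fintype m] [DecidableEq m]
    (A : Matrix m m ℂ) : Matrix m m ℂ :=
  ∑' k : ℕ, ((k.factorial : ℂ)⁻¹) • A ^ k

/-- `⌈X⌉ := X ⊗ X̄`, reindexed to a `4×4` matrix with the row-stacking (row-major)
order `(i,j) ↦ 2i + j` of pairs. -/
noncomputable def corner (X : Matrix (Fin 2) (Fin 2) ℂ) : Matrix (Fin 4) (Fin 4) ℂ :=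
  Matrix.reindex finProdFinEquiv finProdFinEquiv (X ⊗ₖ X.map (starRingEnd ℂ))

/-- The diagonal blocks `G_0, G_1, G_1, G_2` of the generator of Section 6.3. -/
noncomputable def diagBlocks : Fin 4 → Matrix (Fin 4) (Fin 4) ℂ :=
  ![((2 : ℂ))⁻¹ • !![-4, 1, 1, 0; 1, -3, 0, 1; 1, 0, -3, 1; 0, 1, 1, -2],
    (-3 : ℂ) • (1 : Matrix (Fin 4) (Fin 4) ℂ),
    (-3 : ℂ) • (1 : Matrix (Fin 4) (Fin 4) ℂ),
    (-((2 : ℂ))⁻¹) • !![2, 1, 1, 0; 1, 3, 0, 1; 1, 0, 3, 1; 0, 1, 1, 4]]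

lemma vecMul_pow_eig (L : Matrix (Fin 4 × Fin 4) (Fin 4 × Fin 4) ℂ) (u : Fin 4 × Fin 4 → ℂ)
    (μ : ℂ) (h : u ᵥ* L = μ • u) (k : ℕ) : u ᵥ* (L ^ k) = μ ^ k • u := by
  induction k with
  | zero => simp
  | succ k ih =>
    rw [pow_succ, ← Matrix.vecMul_vecMul, ih, Matrix.smul_vecMul, h, smul_smul, pow_succ]

lemma matExp_hasSum (A : Matrix (Fin 4 × Fin 4) (Fin 4 × Fin 4) ℂ) :
    HasSum (fun k : ℕ => ((k.factorial : ℂ)⁻¹) • A ^ k) (matExp A) := by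
  let : NormedRing (Matrix (Fin 4 × Fin 4) (Fin 4 × Fin 4) ℂ) := Matrix.linftyOpNormedRing
  let : NormedAlgebra ℂ (Matrix (Fin 4 × Fin 4) (Fin 4 × Fin 4) ℂ) :=
    Matrix.linftyOpNormedAlgebra
  have h := NormedSpace.expSeries_summable' (𝕂 := ℂ) A
  exact h.hasSum

lemma vecMul_matExp_eig (L : Matrix (Fin 4 × Fin 4) (Fin 4 × Fin 4) ℂ) (u : Fin 4 × Fin 4 → ℂ)
    (μ : ℂ) (h : u ᵥ* L = μ • u) (t : ℂ) :
    u ᵥ* matExp (t • L) = Complex.exp (μ * t) • u := by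
  have h' : u ᵥ* (t • L) = (μ * t) • u := by
    rw [Matrix.vecMul_smul, h, smul_smul, mul_comm]
  funext q
  have h1 : HasSum (fun k : ℕ => (u ᵥ* (((k.factorial : ℂ)⁻¹) • (t • L) ^ k)) q)
      ((u ᵥ* matExp (t • L)) q) := by
    simp only [Matrix.vecMul, dotProduct]
    refine hasSum_sum fun p _ => HasSum.mul_left _ ?_
    exact Pi.hasSum.1 (Pi.hasSum.1 (matExp_hasSum (t • L)) p) q
  have h2 : HasSum (fun k : ℕ => (((k.factorial : ℂ)⁻¹) • (μ * t) ^ k) * u q)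
      (Complex.exp (μ * t) * u q) := by
    refine HasSum.mul_right _ ?_
    rw [Complex.exp_eq_exp_ℂ]
    exact NormedSpace.exp_series_hasSum_exp' (𝕂 := ℂ) (μ * t)
  refine h1.unique ?_
  have h3 : (fun k : ℕ => (u ᵥ* (((k.factorial : ℂ)⁻¹) • (t • L) ^ k)) q) =
      (fun k : ℕ => (((k.factorial : ℂ)⁻¹) • (μ * t) ^ k) * u q) := by
    funext k
    rw [Matrix.vecMul_smul, vecMul_pow_eig _ _ _ h']
    simp [mul_assoc]
  rw [h3]
  exact h2

def ratU : Fin 4 × Fin 4 → ℚ := fun p =>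
  (!![1/4, 0, 0, 1/4; 1/4, 0, 0, 1/4; 1/4, 0, 0, 1/4; 1/4, 0, 0, 1/4] :
    Matrix (Fin 4) (Fin 4) ℚ) p.1 p.2

noncomputable def vecU : Fin 4 × Fin 4 → ℂ := fun p => ((ratU p : ℚ) : ℂ)

def ratP : Fin 4 × Fin 4 → ℚ := fun p =>
  (!![1/4, 0, 0, 1/4; -1/4, 0, 0, -1/4; -1/4, 0, 0, -1/4; 1/4, 0, 0, 1/4] :
    Matrix (Fin 4) (Fin 4) ℚ) p.1 p.2

noncomputable def vecP : Fin 4 × Fin 4 → ℂ := fun p => ((ratP p : ℚ) : ℂ)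

def ratQ : Fin 4 × Fin 4 → ℚ := fun p =>
  (!![-1/20, 1/10, 1/10, 1/20; -1/20, 1/10, 1/10, 1/20; 1/20, -1/10, -1/10, -1/20; 1/20, -1/10, -1/10, -1/20] :
    Matrix (Fin 4) (Fin 4) ℚ) p.1 p.2

noncomputable def vecQ : Fin 4 × Fin 4 → ℂ := fun p => ((ratQ p : ℚ) : ℂ)

def ratR : Fin 4 × Fin 4 → ℚ := fun p =>
  (!![1/2, 0, 0, 1/2; 0, 0, 0, 0; 0, 0, 0, 0; -1/2, 0, 0, -1/2] :
    Matrix (Fin 4) (Fin 4) ℚ) p.1 p.2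

noncomputable def vecR : Fin 4 × Fin 4 → ℂ := fun p => ((ratR p : ℚ) : ℂ)

def ratS : Fin 4 × Fin 4 → ℚ := fun p =>
  (!![1/14, 1/14, 1/14, 1/7; 1/14, 1/14, 1/14, 1/7; -1/7, 1/14, 1/14, -1/14; -1/7, 1/14, 1/14, -1/14] :
    Matrix (Fin 4) (Fin 4) ℚ) p.1 p.2

noncomputable def vecS : Fin 4 × Fin 4 → ℂ := fun p => ((ratS p : ℚ) : ℂ)

/-- The generator. -/
noncomputable def genL : Matrix (Fin 4 × Fin 4) (Fin 4 × Fin 4) ℂ := fun p q =>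
  (if p.1 = q.1 then diagBlocks p.1
          else if (p.1 : ℕ) = (q.1 : ℕ) + 1 then corner !![1, 0; 1, -1]
          else if (q.1 : ℕ) = (p.1 : ℕ) + 1 then corner !![1, 1; 0, -1]
          else 0) p.2 q.2

def ratA : Matrix (Fin 4) (Fin 4) ℚ :=
    !![1, 0, 0, 0; 1, -1, 0, 0; 1, 0, -1, 0; 1, -1, -1, 1]

def ratC : Matrix (Fin 4) (Fin 4) ℚ :=
    !![1, 1, 1, 1; 0, -1, 0, -1; 0, 0, -1, -1; 0, 0, 0, 1]

def ratDiag (i : Fin 4) : Matrix (Fin 4) (Fin 4) ℚ :=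
  if i = 0 then
    !![-2, 1/2, 1/2, 0; 1/2, -3/2, 0, 1/2; 1/2, 0, -3/2, 1/2; 0, 1/2, 1/2, -1]
  else if i = 3 then
    !![-1, -1/2, -1/2, 0; -1/2, -3/2, 0, -1/2; -1/2, 0, -3/2, -1/2; 0, -1/2, -1/2, -2]
  else !![-3, 0, 0, 0; 0, -3, 0, 0; 0, 0, -3, 0; 0, 0, 0, -3]

def ratL : Matrix (Fin 4 × Fin 4) (Fin 4 × Fin 4) ℚ := fun p q =>
  (if p.1 = q.1 then ratDiag p.1
          else if (p.1 : ℕ) = (q.1 : ℕ) + 1 then ratA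
          else if (q.1 : ℕ) = (p.1 : ℕ) + 1 then ratC
          else 0) p.2 q.2

lemma cornerA (i j : Fin 4) : corner !![1, 0; 1, -1] i j = ((ratA i j : ℚ) : ℂ) := by
  fin_cases i <;> fin_cases j <;>
    simp [corner, finProdFinEquiv, Fin.divNat, Fin.modNat, ratA]

lemma cornerC (i j : Fin 4) : corner !![1, 1; 0, -1] i j = ((ratC i j : ℚ) : ℂ) := by
  fin_cases i <;> fin_cases j <;>
    simp [corner, finProdFinEquiv, Fin.divNat, Fin.modNat, ratC]

lemma diag_eq0 (i j : Fin 4) : diagBlocks 0 i j = ((ratDiag 0 i j : ℚ) : ℂ) := by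
  have h : diagBlocks 0 = ((2 : ℂ))⁻¹ •
    !![-4, 1, 1, 0; 1, -3, 0, 1; 1, 0, -3, 1; 0, 1, 1, -2] := rfl
  rw [h, ratDiag, if_pos rfl]
  fin_cases i <;> fin_cases j <;> simp <;> norm_num

lemma diag_eq3 (i j : Fin 4) : diagBlocks 3 i j = ((ratDiag 3 i j : ℚ) : ℂ) := by
  have h : diagBlocks 3 = (-((2 : ℂ))⁻¹) •
    !![2, 1, 1, 0; 1, 3, 0, 1; 1, 0, 3, 1; 0, 1, 1, 4] := rfl
  rw [h, ratDiag, if_neg (by decide), if_pos rfl]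
  fin_cases i <;> fin_cases j <;> simp <;> norm_num

lemma diag_eq12 (k : Fin 4) (h0 : k ≠ 0) (h3 : k ≠ 3) (i j : Fin 4) :
    diagBlocks k i j = ((ratDiag k i j : ℚ) : ℂ) := by
  have h : diagBlocks k = (-3 : ℂ) • (1 : Matrix (Fin 4) (Fin 4) ℂ) := by
    fin_cases k
    · exact absurd rfl h0
    · rfl
    · rfl
    · exact absurd rfl h3
  rw [h, ratDiag, if_neg h0, if_neg h3]
  fin_cases i <;> fin_cases j <;> simp

lemma diag_eq (k i j : Fin 4) : diagBlocks k i j = ((ratDiag k i j : ℚ) : ℂ) := by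
  by_cases h0 : k = 0
  · subst h0; exact diag_eq0 i j
  · by_cases h3 : k = 3
    · subst h3; exact diag_eq3 i j
    · exact diag_eq12 k h0 h3 i j

lemma genL_eq (p q : Fin 4 × Fin 4) : genL p q = ((ratL p q : ℚ) : ℂ) := by
  unfold genL ratL
  split_ifs
  · exact diag_eq _ _ _
  · exact cornerA _ _
  · exact cornerC _ _
  · simp

lemma cast_vecMul (u : Fin 4 × Fin 4 → ℚ) (q : Fin 4 × Fin 4) :
    ((fun p => ((u p : ℚ) : ℂ)) ᵥ* genL) q = (((u ᵥ* ratL) q : ℚ) : ℂ) := by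
  simp only [Matrix.vecMul, dotProduct, genL_eq]
  push_cast
  rfl

lemma ratL_U : ∀ q, (ratU ᵥ* ratL) q = 0 := by
  decide +kernel

lemma genL_U : vecU ᵥ* genL = 0 := by
  funext q
  have h := cast_vecMul ratU q
  rw [ratL_U] at h
  refine h.trans ?_
  simp

lemma ratL_P : ∀ q, (ratP ᵥ* ratL) q = -3 * ratP q + 5 * ratQ q := by
  decide +kernel

lemma genL_P : vecP ᵥ* genL = (-3 : ℂ) • vecP + (5 : ℂ) • vecQ := by
  funext q
  have h := cast_vecMul ratP q
  rw [ratL_P] at h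
  refine h.trans ?_
  simp [vecP, vecQ]

lemma ratL_Q : ∀ q, (ratQ ᵥ* ratL) q = ratP q + -3 * ratQ q := by
  decide +kernel

lemma genL_Q : vecQ ᵥ* genL = vecP + (-3 : ℂ) • vecQ := by
  funext q
  have h := cast_vecMul ratQ q
  rw [ratL_Q] at h
  refine h.trans ?_
  simp [vecQ, vecP]

lemma ratL_R : ∀ q, (ratR ᵥ* ratL) q = -3 * ratR q + 7 * ratS q := by
  decide +kernel

lemma genL_R : vecR ᵥ* genL = (-3 : ℂ) • vecR + (7 : ℂ) • vecS := by
  funext q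
  have h := cast_vecMul ratR q
  rw [ratL_R] at h
  refine h.trans ?_
  simp [vecR, vecS]

lemma ratL_S : ∀ q, (ratS ᵥ* ratL) q = ratR q + -3 * ratS q := by
  decide +kernel

lemma genL_S : vecS ᵥ* genL = vecR + (-3 : ℂ) • vecS := by
  funext q
  have h := cast_vecMul ratS q
  rw [ratL_S] at h
  refine h.trans ?_
  simp [vecS, vecR]

lemma comb_vecMul (M : Matrix (Fin 4 × Fin 4) (Fin 4 × Fin 4) ℂ)
    (a b c d e : Fin 4 × Fin 4 → ℂ) (x : ℂ) :
    (a + (x • b + x • c) + (x • d + x • e)) ᵥ* M =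
      a ᵥ* M + (x • (b ᵥ* M) + x • (c ᵥ* M)) + (x • (d ᵥ* M) + x • (e ᵥ* M)) := by
  simp only [Matrix.add_vecMul, Matrix.smul_vecMul]

lemma eig_pair (L : Matrix (Fin 4 × Fin 4) (Fin 4 × Fin 4) ℂ) (P Q : Fin 4 × Fin 4 → ℂ)
    (n s : ℂ) (hs : s * s = n) (hP : P ᵥ* L = (-3 : ℂ) • P + n • Q)
    (hQ : Q ᵥ* L = P + (-3 : ℂ) • Q) :
    (P + s • Q) ᵥ* L = (-3 + s) • (P + s • Q) := by
  rw [Matrix.add_vecMul, Matrix.smul_vecMul, hP, hQ, ← hs]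
  module

/-- **Section 6.3: explicit return probability.**
For the `16×16` block tridiagonal generator `L̂` of the noncommuting-transitions example
and any `2×2` density matrix `ρ = [[a,b],[b̄,1−a]]`, the return probability
`p_{00;ρ}(t) = Tr(vec⁻¹((e^{tL̂})_{00} vec ρ))` equals
`1/4 + (e^{−λ₂t} − e^{−λ₃t})v₁ + (e^{−λ₂t} + e^{−λ₃t})/8
     + (e^{−λ₄t} − e^{−λ₅t})v₂ + (e^{−λ₄t} + e^{−λ₅t})/4`
with `λ₂ = 3−√5, λ₃ = 3+√5, λ₄ = 3−√7, λ₅ = 3+√7`,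
`v₁ = (√5/40)(1 − 2a + 4 Re b)` and `v₂ = (√7/28)(2 − a + 2 Re b)`. -/
theorem stmt15
    (L : Matrix (Fin 4 × Fin 4) (Fin 4 × Fin 4) ℂ)
    (hL : ∀ p q : Fin 4 × Fin 4,
      L p q = (if p.1 = q.1 then diagBlocks p.1
          else if (p.1 : ℕ) = (q.1 : ℕ) + 1 then corner !![1, 0; 1, -1]
          else if (q.1 : ℕ) = (p.1 : ℕ) + 1 then corner !![1, 1; 0, -1]
          else 0) p.2 q.2)
    (ρ : Matrix (Fin 2) (Fin 2) ℂ) (hρ : ρ.PosSemidef) (htr : ρ.trace = 1) :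
    ∀ t : ℝ, 0 ≤ t →
      ((Matrix.of fun r s : Fin 4 => matExp ((t : ℂ) • L) ((0, r)) ((0, s)))
            *ᵥ ![ρ 0 0, ρ 0 1, ρ 1 0, ρ 1 1]) 0
        + ((Matrix.of fun r s : Fin 4 => matExp ((t : ℂ) • L) ((0, r)) ((0, s)))
            *ᵥ ![ρ 0 0, ρ 0 1, ρ 1 0, ρ 1 1]) 3
      = ((1 / 4
          + (Real.exp (-((3 - Real.sqrt 5) * t)) - Real.exp (-((3 + Real.sqrt 5) * t)))
              * (Real.sqrt 5 / 40 * (1 - 2 * (ρ 0 0).re + 4 * (ρ 0 1).re))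
          + (Real.exp (-((3 - Real.sqrt 5) * t)) + Real.exp (-((3 + Real.sqrt 5) * t))) / 8
          + (Real.exp (-((3 - Real.sqrt 7) * t)) - Real.exp (-((3 + Real.sqrt 7) * t)))
              * (Real.sqrt 7 / 28 * (2 - (ρ 0 0).re + 2 * (ρ 0 1).re))
          + (Real.exp (-((3 - Real.sqrt 7) * t)) + Real.exp (-((3 + Real.sqrt 7) * t))) / 4
          : ℝ) : ℂ) := by
  intro t _
  have hLg : L = genL := by
    ext p q
    exact hL p q
  subst hLg
  have h5 : ((Real.sqrt 5 : ℝ) : ℂ) * ((Real.sqrt 5 : ℝ) : ℂ) = 5 := by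
    rw [← Complex.ofReal_mul, Real.mul_self_sqrt (by norm_num)]; norm_num
  have h7 : ((Real.sqrt 7 : ℝ) : ℂ) * ((Real.sqrt 7 : ℝ) : ℂ) = 7 := by
    rw [← Complex.ofReal_mul, Real.mul_self_sqrt (by norm_num)]; norm_num
  set s : ℂ := ((Real.sqrt 5 : ℝ) : ℂ) with hs
  set r : ℂ := ((Real.sqrt 7 : ℝ) : ℂ) with hr
  have e1 := vecMul_matExp_eig genL vecU 0 (by rw [genL_U, zero_smul]) t
  have e2 := vecMul_matExp_eig genL _ _ (eig_pair genL vecP vecQ 5 s h5 genL_P genL_Q) t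
  have e3 := vecMul_matExp_eig genL _ _
    (eig_pair genL vecP vecQ 5 (-s) (by rw [neg_mul_neg, h5]) genL_P genL_Q) t
  have e4 := vecMul_matExp_eig genL _ _ (eig_pair genL vecR vecS 7 r h7 genL_R genL_S) t
  have e5 := vecMul_matExp_eig genL _ _
    (eig_pair genL vecR vecS 7 (-r) (by rw [neg_mul_neg, h7]) genL_R genL_S) t
  set M := matExp ((t : ℂ) • genL) with hM
  have hw : (fun p => if p = (0, 0) then 1 else if p = (0, 3) then 1 else 0 :
      Fin 4 × Fin 4 → ℂ) = vecU + ((1 / 2 : ℂ) • (vecP + s • vecQ)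
        + (1 / 2 : ℂ) • (vecP + (-s) • vecQ))
        + ((1 / 2 : ℂ) • (vecR + r • vecS) + (1 / 2 : ℂ) • (vecR + (-r) • vecS)) := by
    funext ⟨i, j⟩
    fin_cases i <;> fin_cases j <;> simp [vecU, vecP, vecQ, vecR, vecS, ratU, ratP, ratQ, ratR, ratS] <;> ring
  have key : ∀ q, M (0, 0) q + M (0, 3) q =
      vecU q + ((1 / 2 : ℂ) * (Complex.exp ((-3 + s) * t) * (vecP q + s * vecQ q))
        + (1 / 2 : ℂ) * (Complex.exp ((-3 + -s) * t) * (vecP q - s * vecQ q)))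
        + ((1 / 2 : ℂ) * (Complex.exp ((-3 + r) * t) * (vecR q + r * vecS q))
        + (1 / 2 : ℂ) * (Complex.exp ((-3 + -r) * t) * (vecR q - r * vecS q))) := by
    intro q
    have h := congrArg (fun w => (w ᵥ* M) q) hw
    beta_reduce at h
    rw [comb_vecMul, e1, e2, e3, e4, e5] at h
    have hl : ((fun p => if p = (0, 0) then 1 else if p = (0, 3) then 1 else 0 :
      Fin 4 × Fin 4 → ℂ) ᵥ* M) q = M (0, 0) q + M (0, 3) q := by
      simp [Matrix.vecMul, dotProduct, Fintype.sum_prod_type, Fin.sum_univ_four]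
    rw [← hl, h]
    simp [sub_eq_add_neg, mul_add]
  have hsum : ((Matrix.of fun r s : Fin 4 => M (0, r) (0, s))
            *ᵥ ![ρ 0 0, ρ 0 1, ρ 1 0, ρ 1 1]) 0
        + ((Matrix.of fun r s : Fin 4 => M (0, r) (0, s))
            *ᵥ ![ρ 0 0, ρ 0 1, ρ 1 0, ρ 1 1]) 3
      = (M (0, 0) (0, 0) + M (0, 3) (0, 0)) * ρ 0 0 + (M (0, 0) (0, 1) + M (0, 3) (0, 1)) * ρ 0 1
        + (M (0, 0) (0, 2) + M (0, 3) (0, 2)) * ρ 1 0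
        + (M (0, 0) (0, 3) + M (0, 3) (0, 3)) * ρ 1 1 := by
    simp [Matrix.mulVec, dotProduct, Fin.sum_univ_four]
    ring
  rw [hsum, key, key, key, key]
  have hH := hρ.isHermitian
  have h00 : ρ 0 0 = ((ρ 0 0).re : ℂ) := by
    have := hH.apply 0 0
    exact (Complex.conj_eq_iff_re.1 this).symm
  have h11 : ρ 1 1 = 1 - ((ρ 0 0).re : ℂ) := by
    rw [← h00, ← htr, Matrix.trace_fin_two]; ring
  have h10 : ρ 1 0 = 2 * ((ρ 0 1).re : ℂ) - ρ 0 1 := by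
    have h1 := hH.apply 1 0
    have h2 := Complex.add_conj (ρ 0 1)
    have h3 : (starRingEnd ℂ) (ρ 0 1) = ρ 1 0 := h1
    rw [h3] at h2
    push_cast at h2
    linear_combination h2
  have x1 : ((-3 + s) * t) = -((3 - s) * t) := by ring
  have x2 : ((-3 + -s) * t) = -((3 + s) * t) := by ring
  have x3 : ((-3 + r) * t) = -((3 - r) * t) := by ring
  have x4 : ((-3 + -r) * t) = -((3 + r) * t) := by ring
  rw [h11, h10, x1, x2, x3, x4, h00]
  push_cast
  simp only [← hs, ← hr, Complex.ofReal_re]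
  simp [vecU, vecP, vecQ, vecR, vecS, ratU, ratP, ratQ, ratR, ratS]
  ring
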